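/- Let x and the linear operator η_{a;q} satisfy xa = qax and η_{a;q}(c(a;q)x^n) = c(a;q)·[(1-aq^{1+n})(1-aq^{2+n})/((1-aq)(1-aq²))]·q^{-n}x^n. Then for all n ∈ ℕ₀: (x + x²η_{a;q})^n x = (Σ_{j=0}^n q^{-nj} [n choose j]_q · [(1-aq^{n+j+2})^j(1-aq^{n+j+3})^j/((aq³;q)_j(aq^{n+3};q)_j)] x^j) · x^{n+1}. -/

import Mathlib

/-- The `q`-shifted factorial `(a;q)_n = ∏_{j=0}^{n-1} (1 - a q^j)`. -/
def qPoch {K : Type*} [Field K] (a q : K) (n : ℕ) : K :=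
  ∏ j ∈ Finset.range n, (1 - a * q ^ j)

/-- The `q`-binomial coefficient `[n,k]_q = (q^{1+k};q)_{n-k}/(q;q)_{n-k}` for
`0 ≤ k ≤ n`, and `0` for `k > n` (the upper index is allowed to be a negative integer,
in which case the coefficient is `0`). -/
def qBinom {K : Type*} [Field K] (q : K) (n : ℤ) (k : ℕ) : K :=
  if n < (k : ℤ) then 0 else
    qPoch (q ^ ((k : ℤ) + 1)) q (n - k).toNat / qPoch q q (n - k).toNat

/- The span of monomials `c(a)·x^N` (with `x a = q a x`, so `x·c(a)x^N = c(aq)x^{N+1}`)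
is modelled by functions `m : ℕ → ℤ → K`, where `m N i` is the coefficient `c(aq^i)`. -/

/-- The operator `x`. -/
def opX2 {K : Type*} [Field K] (m : ℕ → ℤ → K) : ℕ → ℤ → K
  | 0, _ => 0
  | n + 1, i => m n (i + 1)

/-- The operator `η_{a;q}(c(a)x^n) =
c(a)·[(1-aq^{1+n})(1-aq^{2+n})/((1-aq)(1-aq²))]·q^{-n}·x^n`. -/
def opEta2 {K : Type*} [Field K] (a q : K) (m : ℕ → ℤ → K) : ℕ → ℤ → K :=
  fun n i =>
    m n i * ((1 - a * q ^ (i + 1 + (n : ℤ))) * (1 - a * q ^ (i + 2 + (n : ℤ)))) /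
      ((1 - a * q ^ (i + 1)) * (1 - a * q ^ (i + 2))) * q ^ (-(n : ℤ))

/-- The element `1` (the vacuum). -/
def vac {K : Type*} [Field K] : ℕ → ℤ → K := fun n _ => if n = 0 then 1 else 0

section QPochhammer

variable {K : Type*} [Field K]

theorem qPoch_zero (a q : K) : qPoch a q 0 = 1 := by simp [qPoch]

theorem qPoch_succ (a q : K) (n : ℕ) :
    qPoch a q (n + 1) = qPoch a q n * (1 - a * q ^ n) :=
  Finset.prod_range_succ _ _

theorem qPoch_succ' (a q : K) (n : ℕ) :
    qPoch a q (n + 1) = (1 - a) * qPoch (a * q) q n := by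
  simp only [qPoch, Finset.prod_range_succ', pow_zero, mul_one, pow_succ', mul_assoc]
  rw [mul_comm]

theorem qPoch_add (a q : K) (m n : ℕ) :
    qPoch a q (m + n) = qPoch a q m * qPoch (a * q ^ m) q n := by
  simp only [qPoch, Finset.prod_range_add, pow_add, mul_assoc]

theorem qPoch_ne_zero {a q : K} {n : ℕ} (h : ∀ j, 1 - a * q ^ j ≠ 0) : qPoch a q n ≠ 0 :=
  Finset.prod_ne_zero_iff.2 fun j _ => h j

end QPochhammer

section QBinomial

variable {K : Type*} [Field K] {q : K}

theorem one_sub_mul_pow_ne_zero (hq1 : ∀ m : ℕ, q ^ (m + 1) ≠ 1) (j : ℕ) :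
    1 - q * q ^ j ≠ 0 := by
  rw [← pow_succ', sub_ne_zero]
  exact (hq1 j).symm

theorem qBinom_of_lt {n k : ℕ} (h : n < k) : qBinom q n k = 0 :=
  if_pos (by exact_mod_cast h)

theorem qBinom_add (hq1 : ∀ m : ℕ, q ^ (m + 1) ≠ 1) (k d : ℕ) :
    qBinom q ((k + d : ℕ) : ℤ) k = qPoch q q (k + d) / (qPoch q q k * qPoch q q d) := by
  have hk : qPoch q q k ≠ 0 := qPoch_ne_zero (one_sub_mul_pow_ne_zero hq1)
  have hd : qPoch q q d ≠ 0 := qPoch_ne_zero (one_sub_mul_pow_ne_zero hq1)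
  have e : (((k + d : ℕ) : ℤ) - k).toNat = d := by omega
  have e' : q ^ ((k : ℤ) + 1) = q * q ^ k := by
    rw [← pow_succ']
    exact_mod_cast zpow_natCast q (k + 1)
  rw [qBinom, if_neg (by omega), e, e', qPoch_add]
  field_simp

theorem qBinom_zero_right (hq1 : ∀ m : ℕ, q ^ (m + 1) ≠ 1) (n : ℕ) :
    qBinom q n 0 = 1 := by
  have h := qBinom_add hq1 0 n
  rw [zero_add, qPoch_zero, one_mul,
    div_self (qPoch_ne_zero (one_sub_mul_pow_ne_zero hq1))] at h
  exact h

/-- A one-parameter combination of the two `q`-Pascal rules. -/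
theorem qBinom_succ_succ_mul (hq1 : ∀ m : ℕ, q ^ (m + 1) ≠ 1) (c : K) (n k : ℕ) :
    qBinom q ((n + 1 : ℕ) : ℤ) (k + 1) * (1 - c * q ^ (k + 1)) =
      q ^ (k + 1) * qBinom q n (k + 1) * (1 - c) +
        qBinom q n k * (1 - c * q ^ (n + 1)) := by
  have h := one_sub_mul_pow_ne_zero hq1
  rcases lt_trichotomy n k with hnk | rfl | hnk
  · rw [qBinom_of_lt hnk, qBinom_of_lt (by omega), qBinom_of_lt (by omega)]
    ring
  · have h₁ := qBinom_add hq1 n 0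
    have h₂ := qBinom_add hq1 (n + 1) 0
    have h₀ (m : ℕ) : qPoch q q m ≠ 0 := qPoch_ne_zero h
    rw [add_zero, qPoch_zero, mul_one, div_self (h₀ _)] at h₁ h₂
    rw [h₁, h₂, qBinom_of_lt (by omega)]
    ring
  · obtain ⟨d, rfl⟩ := Nat.exists_eq_add_of_lt hnk
    have h₁ := qBinom_add hq1 k (d + 1)
    have h₂ := qBinom_add hq1 (k + 1) d
    have h₃ := qBinom_add hq1 (k + 1) (d + 1)
    have hk : qPoch q q k ≠ 0 := qPoch_ne_zero h
    have hd : qPoch q q d ≠ 0 := qPoch_ne_zero h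
    have hk' := h k
    have hd' := h d
    rw [show k + 1 + d = k + d + 1 by ring] at h₂
    rw [show k + 1 + (d + 1) = k + d + 1 + 1 by ring] at h₃
    rw [← add_assoc] at h₁
    rw [h₁, h₂, h₃, qPoch_succ q q (k + d + 1), qPoch_succ q q k, qPoch_succ q q d]
    field_simp
    ring

end QBinomial

section Iterate

variable {K : Type*} [Field K]

/-- The coefficient of `x ^ (n + 1 + j)` in `(x + x²η)^n x`, with `b` the current shift
of `a`. -/
def iterCoeff (b q : K) (n j : ℕ) : K :=
  (q ^ (n * j))⁻¹ * qBinom q n j *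
    ((1 - b * q ^ (n + j + 2)) ^ j * (1 - b * q ^ (n + j + 3)) ^ j) /
      (qPoch (b * q ^ 3) q j * qPoch (b * q ^ (n + 3)) q j)

theorem iterCoeff_of_lt (b q : K) {n j : ℕ} (h : n < j) : iterCoeff b q n j = 0 := by
  simp [iterCoeff, qBinom_of_lt h]

theorem iterCoeff_zero_right {q : K} (hq1 : ∀ m : ℕ, q ^ (m + 1) ≠ 1) (b : K) (n : ℕ) :
    iterCoeff b q n 0 = 1 := by
  simp [iterCoeff, qPoch_zero, qBinom_zero_right hq1]

theorem iterCoeff_succ_succ {b q : K} (hq0 : q ≠ 0) (hq1 : ∀ m : ℕ, q ^ (m + 1) ≠ 1)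
    (hb : ∀ m : ℕ, 1 - b * q ^ m ≠ 0) (n j : ℕ) :
    iterCoeff b q (n + 1) (j + 1) =
      iterCoeff (b * q) q n (j + 1) +
        iterCoeff (b * q ^ 2) q n j *
          ((1 - b * q ^ (n + j + 4)) * (1 - b * q ^ (n + j + 5))) /
            ((1 - b * q ^ 3) * (1 - b * q ^ 4)) * (q ^ (n + 1 + j))⁻¹ := by
  have hP (k m : ℕ) : qPoch (b * q ^ k) q m ≠ 0 :=
    qPoch_ne_zero fun l => by rw [mul_assoc, ← pow_add]; exact hb _
  have e₁ : qPoch (b * q ^ 4) q (j + 1) = (1 - b * q ^ 4) * qPoch (b * q ^ 5) q j := by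
    rw [qPoch_succ', mul_assoc, ← pow_succ]
  have e₂ : qPoch (b * q ^ (n + 4)) q (j + 1) =
      (1 - b * q ^ (n + 4)) * qPoch (b * q ^ (n + 5)) q j := by
    rw [qPoch_succ', mul_assoc, ← pow_succ]
  have e₃ : qPoch (b * q ^ 3) q (j + 1) =
      (1 - b * q ^ 3) * ((1 - b * q ^ 4) * qPoch (b * q ^ 5) q j) /
        (1 - b * q ^ (j + 4)) := by
    rw [eq_div_iff (hb _), ← e₁, show b * q ^ 4 = b * q ^ 3 * q by ring, ← qPoch_succ',
      qPoch_succ _ _ (j + 1)]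
    ring
  have key := qBinom_succ_succ_mul hq1 (b * q ^ 3) n j
  have h₃ := hb 3
  have h₄ := hb 4
  have hj := hb (j + 4)
  have hn := hb (n + 4)
  have hX := hP 5 j
  have hY := hP (n + 5) j
  unfold iterCoeff
  rw [show b * q * q ^ 3 = b * q ^ 4 by ring,
    show b * q * q ^ (n + 3) = b * q ^ (n + 4) by ring,
    show b * q ^ 2 * q ^ 3 = b * q ^ 5 by ring,
    show b * q ^ 2 * q ^ (n + 3) = b * q ^ (n + 5) by ring,
    show b * q * q ^ (n + (j + 1) + 2) = b * q ^ (n + j + 4) by ring,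
    show b * q * q ^ (n + (j + 1) + 3) = b * q ^ (n + j + 5) by ring,
    show b * q ^ 2 * q ^ (n + j + 2) = b * q ^ (n + j + 4) by ring,
    show b * q ^ 2 * q ^ (n + j + 3) = b * q ^ (n + j + 5) by ring,
    show n + 1 + (j + 1) + 2 = n + j + 4 by ring,
    show n + 1 + (j + 1) + 3 = n + j + 5 by ring,
    show n + 1 + 3 = n + 4 by ring, e₁, e₂, e₃,
    show (n + 1) * (j + 1) = n * j + n + (j + 1) by ring,
    show n * (j + 1) = n * j + n by ring,
    show n + 1 + j = n + (j + 1) by ring,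
    pow_add q (n * j + n), pow_add q (n * j), pow_add q n (j + 1),
    pow_succ (1 - b * q ^ (n + j + 4)) j, pow_succ (1 - b * q ^ (n + j + 5)) j]
  rw [show b * q ^ 3 * q ^ (j + 1) = b * q ^ (j + 4) by ring,
    show b * q ^ 3 * q ^ (n + 1) = b * q ^ (n + 4) by ring] at key
  generalize 1 - b * q ^ (n + j + 4) = u, 1 - b * q ^ (n + j + 5) = v,
    1 - b * q ^ 3 = w₃, 1 - b * q ^ 4 = w₄, 1 - b * q ^ (j + 4) = wj,
    1 - b * q ^ (n + 4) = wn, qPoch (b * q ^ 5) q j = X,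
    qPoch (b * q ^ (n + 5)) q j = Y at *
  have hr : q ^ (j + 1) ≠ 0 := pow_ne_zero _ hq0
  have hs : q ^ (n * j) ≠ 0 := pow_ne_zero _ hq0
  have ht : q ^ n ≠ 0 := pow_ne_zero _ hq0
  generalize q ^ (j + 1) = r, q ^ (n * j) = s, q ^ n = t at *
  field_simp
  linear_combination u * u ^ j * v * v ^ j * key

/-- The element `∑ j, iterCoeff n j x^(n + 1 + j)`. -/
def iterElem (a q : K) (n : ℕ) : ℕ → ℤ → K := fun N i =>
  if n + 1 ≤ N then iterCoeff (a * q ^ i) q n (N - (n + 1)) else 0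

theorem iterElem_of_lt (a q : K) {n N : ℕ} (h : N < n + 1) (i : ℤ) :
    iterElem a q n N i = 0 := if_neg (by omega)

theorem iterElem_add (a q : K) (n j : ℕ) (i : ℤ) :
    iterElem a q n (n + 1 + j) i = iterCoeff (a * q ^ i) q n j := by
  simp [iterElem]

theorem iterElem_zero {q : K} (hq1 : ∀ m : ℕ, q ^ (m + 1) ≠ 1) (a : K) :
    iterElem a q 0 = opX2 vac := by
  funext N i
  rcases N with _ | _ | N
  · rfl
  · simpa [iterElem, opX2, vac] using iterCoeff_zero_right hq1 _ 0
  · simpa [iterElem, opX2, vac] using iterCoeff_of_lt _ q (Nat.succ_pos N)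

theorem iterElem_succ {a q : K} (hq0 : q ≠ 0) (hq1 : ∀ m : ℕ, q ^ (m + 1) ≠ 1)
    (haq : ∀ m : ℤ, 1 - a * q ^ m ≠ 0) (n : ℕ) :
    iterElem a q (n + 1) =
      opX2 (iterElem a q n) + opX2 (opX2 (opEta2 a q (iterElem a q n))) := by
  funext N i
  rcases N with _ | _ | N
  · simp [iterElem, opX2]
  · simp [iterElem, opX2]
  simp only [Pi.add_apply, opX2, opEta2]
  rcases lt_trichotomy N n with h | rfl | h
  · simp [iterElem_of_lt a q (show N + 1 + 1 < n + 1 + 1 by omega),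
      iterElem_of_lt a q (show N + 1 < n + 1 by omega),
      iterElem_of_lt a q (show N < n + 1 by omega)]
  · have h₁ := iterElem_add a q (N + 1) 0 i
    have h₂ := iterElem_add a q N 0 (i + 1)
    rw [add_zero, iterCoeff_zero_right hq1] at h₁ h₂
    simp [h₁, h₂, iterElem_of_lt a q (Nat.lt_succ_self N)]
  · obtain ⟨j, rfl⟩ := Nat.exists_eq_add_of_lt h
    have hz (k : ℕ) (l : ℤ) (hl : l = i + k) : a * q ^ l = a * q ^ i * q ^ k := by
      rw [hl, zpow_add₀ hq0, zpow_natCast, mul_assoc]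
    have hb (m : ℕ) : 1 - a * q ^ i * q ^ m ≠ 0 := by
      rw [← hz m _ rfl]
      exact haq _
    have key := iterCoeff_succ_succ hq0 hq1 hb n j
    rw [show n + j + 1 + 1 + 1 = n + 1 + 1 + (j + 1) by ring,
      show n + j + 1 + 1 = n + 1 + (j + 1) by ring,
      show n + j + 1 = n + 1 + j by ring, iterElem_add, iterElem_add, iterElem_add, key,
      zpow_neg, zpow_natCast, hz 1 (i + 1) (by simp), pow_one,
      hz 2 (i + 1 + 1) (by push_cast; ring), hz 3 (i + 1 + 1 + 1) (by push_cast; ring),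
      hz 4 (i + 1 + 1 + 2) (by push_cast; ring),
      hz (n + j + 4) (i + 1 + 1 + 1 + ((n + 1 + j : ℕ) : ℤ)) (by push_cast; ring),
      hz (n + j + 5) (i + 1 + 1 + 2 + ((n + 1 + j : ℕ) : ℤ)) (by push_cast; ring)]

end Iterate

/-- For all `n`: `(x + x²η_{a;q})^n x = (∑_{j=0}^n q^{-nj} [n,j]_q ·
(1-aq^{n+j+2})^j(1-aq^{n+j+3})^j/((aq³;q)_j (aq^{n+3};q)_j) x^j)·x^{n+1}`. -/
theorem stmt17 {K : Type*} [Field K] (a q : K)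
    (hq0 : q ≠ 0) (hq1 : ∀ m : ℕ, q ^ (m + 1) ≠ 1)
    (haq : ∀ m : ℤ, 1 - a * q ^ m ≠ 0)
    (n : ℕ) :
    (fun m => opX2 m + opX2 (opX2 (opEta2 a q m)))^[n] (opX2 (vac (K := K))) =
      ∑ j ∈ Finset.range (n + 1),
        (fun N i => if N = n + 1 + j then
            q ^ (-((n : ℤ) * j)) * qBinom q n j *
              ((1 - a * q ^ (i + (n : ℤ) + j + 2)) ^ j *
                (1 - a * q ^ (i + (n : ℤ) + j + 3)) ^ j) /
              (qPoch (a * q ^ (i + 3)) q j * qPoch (a * q ^ (i + (n : ℤ) + 3)) q j)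
          else 0 : ℕ → ℤ → K) := by
  have hz (k : ℕ) (i l : ℤ) (hl : l = i + k) : a * q ^ l = a * q ^ i * q ^ k := by
    rw [hl, zpow_add₀ hq0, zpow_natCast, mul_assoc]
  trans iterElem a q n
  · induction n with
    | zero => exact (iterElem_zero hq1 a).symm
    | succ n ih => rw [Function.iterate_succ_apply', ih, iterElem_succ hq0 hq1 haq]
  funext N i
  rw [Finset.sum_apply, Finset.sum_apply]
  by_cases hN : n + 1 ≤ N
  · obtain ⟨j, rfl⟩ := Nat.exists_eq_add_of_le hN
    rw [iterElem_add]
    by_cases hj : j ≤ n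
    · rw [Finset.sum_eq_single_of_mem j (by simpa [Nat.lt_succ_iff] using hj)
        fun k _ hk => if_neg (by omega), if_pos rfl, iterCoeff, zpow_neg,
        hz (n + j + 2) i (i + n + j + 2) (by push_cast; ring),
        hz (n + j + 3) i (i + n + j + 3) (by push_cast; ring),
        hz 3 i (i + 3) (by push_cast; ring), hz (n + 3) i (i + n + 3) (by push_cast; ring)]
      norm_cast
    · rw [iterCoeff_of_lt _ _ (by omega)]
      refine (Finset.sum_eq_zero fun k hk => if_neg ?_).symm
      rw [Finset.mem_range] at hk
      omega
  · rw [iterElem_of_lt _ _ (by omega)]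
    exact (Finset.sum_eq_zero fun k _ => if_neg (by omega)).symm
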